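/- Let p, q : ℕ → ℝ both satisfy the recurrence u(n) = (2n-1)(17n² - 17n + 5)·u(n-1) - (n-1)⁶·u(n-2) for all n ≥ 2, with initial values p(0) = 0, p(1) = 6, q(0) = 1, q(1) = 5. Then q(n) ≠ 0 for all n, the sequence p(n)/q(n) converges to ζ(3), and moreover ζ(3) - p(n)/q(n) is asymptotically equivalent (as n → ∞) to 4π³/(1+√2)^{8n+4}. -/

import Mathlib

open Filter Real Asymptotics

/-- The product `C(n,k) C(n+k,k)`, whose squares sum to the Apéry numbers. -/
noncomputable def aperyTerm (n k : ℕ) : ℝ := (n.choose k : ℝ) * ((n + k).choose k : ℝ)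

lemma aperyTerm_zero_right (n : ℕ) : aperyTerm n 0 = 1 := by simp [aperyTerm]

lemma aperyTerm_eq_zero {n k : ℕ} (h : n < k) : aperyTerm n k = 0 := by
  simp [aperyTerm, Nat.choose_eq_zero_of_lt h]

lemma aperyTerm_nonneg (n k : ℕ) : 0 ≤ aperyTerm n k := by
  unfold aperyTerm; positivity

lemma aperyTerm_pos {n k : ℕ} (h : k ≤ n) : 0 < aperyTerm n k := by
  have h1 : 0 < n.choose k := Nat.choose_pos h
  have h2 : 0 < (n + k).choose k := Nat.choose_pos (by omega)
  unfold aperyTerm; positivity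

lemma add_choose_succ_left (n k : ℕ) :
    ((n + k + 1).choose k : ℝ) * (n + 1) = (n + k + 1) * (n + k).choose k := by
  have h := Nat.choose_mul_succ_eq (n + k) k
  rw [show n + k + 1 - k = n + 1 by omega] at h
  have h' : ((n + k).choose k : ℝ) * (n + k + 1) = (n + k + 1).choose k * (n + 1) := by
    exact_mod_cast h
  linarith

lemma add_choose_succ_right (n k : ℕ) :
    ((n + k + 1).choose (k + 1) : ℝ) * (k + 1) = (n + k + 1) * (n + k).choose k := by
  have h := Nat.add_one_mul_choose_eq (n + k) k
  have h' : ((n : ℝ) + k + 1) * (n + k).choose k = (n + k + 1).choose (k + 1) * (k + 1) := by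
    exact_mod_cast h
  linarith

lemma choose_succ_right_cast (n k : ℕ) :
    (n.choose (k + 1) : ℝ) * (k + 1) = n.choose k * (n - k) := by
  rcases le_or_gt k n with h | h
  · have := Nat.choose_succ_right_eq n k
    have h' : ((n.choose (k + 1) * (k + 1) : ℕ) : ℝ) = (n.choose k * (n - k) : ℕ) := by rw [this]
    push_cast [Nat.cast_sub h] at h'
    exact h'
  · simp [Nat.choose_eq_zero_of_lt h, Nat.choose_eq_zero_of_lt (h.trans (Nat.lt_succ_self k))]

lemma aperyTerm_succ_right (n k : ℕ) :
    aperyTerm n (k + 1) * ((k : ℝ) + 1) ^ 2 = aperyTerm n k * (n + k + 1) * (n - k) := by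
  have h1 := choose_succ_right_cast n k
  have h2 := add_choose_succ_right n k
  unfold aperyTerm
  rw [show n + (k + 1) = n + k + 1 by ring]
  linear_combination ((n + k + 1).choose (k + 1) : ℝ) * (k + 1) * h1
    + (n.choose k : ℝ) * (n - k) * h2

lemma aperyTerm_succ_left (n k : ℕ) :
    aperyTerm (n + 1) k * ((n : ℝ) + 1 - k) = aperyTerm n k * (n + 1 + k) := by
  have h1 : ((n + 1).choose k : ℝ) * (n + 1 - k) = n.choose k * (n + 1) := by
    rcases le_or_gt k (n + 1) with h | h
    · have := Nat.choose_mul_succ_eq n k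
      have h' : ((n.choose k * (n + 1) : ℕ) : ℝ) = ((n + 1).choose k * (n + 1 - k) : ℕ) := by
        rw [this]
      push_cast [Nat.cast_sub h] at h'
      exact h'.symm
    · simp [Nat.choose_eq_zero_of_lt h, Nat.choose_eq_zero_of_lt ((Nat.lt_succ_self n).trans h)]
  have h2 := add_choose_succ_left n k
  unfold aperyTerm
  rw [show n + 1 + k = n + k + 1 by ring]
  linear_combination ((n + k + 1).choose k : ℝ) * h1 + (n.choose k : ℝ) * h2

lemma aperyTerm_succ_succ (n k : ℕ) :
    aperyTerm (n + 1) (k + 1) * ((k : ℝ) + 1) ^ 2 =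
      aperyTerm n k * (n + k + 1) * (n + k + 2) := by
  have h1 : ((n + 1).choose (k + 1) : ℝ) * (k + 1) = (n + 1) * n.choose k := by
    exact_mod_cast (Nat.add_one_mul_choose_eq n k).symm
  have h2 := add_choose_succ_right (n + 1) k
  have h3 := add_choose_succ_left n k
  rw [show n + 1 + k = n + k + 1 by ring] at h2
  push_cast at h2
  unfold aperyTerm
  rw [show n + 1 + (k + 1) = n + k + 1 + 1 by ring]
  linear_combination ((n + k + 1 + 1).choose (k + 1) : ℝ) * (k + 1) * h1
    + (n.choose k : ℝ) * (n + 1) * h2 + (n.choose k : ℝ) * (n + k + 2) * h3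

lemma aperyTerm_pred_succ (n k : ℕ) :
    aperyTerm n (k + 1) * ((k : ℝ) + 1) ^ 2 = aperyTerm (n + 1) k * (n - k) * (n + 1 - k) := by
  linear_combination aperyTerm_succ_right n k - (n - k : ℝ) * aperyTerm_succ_left n k

/-- The polynomial coefficient of the Apéry recurrence centred at `n + 1`. -/
noncomputable def aperyCoeff (n : ℕ) : ℝ :=
  (2 * (n : ℝ) + 3) * (17 * ((n : ℝ) + 2) ^ 2 - 17 * ((n : ℝ) + 2) + 5)

/-- The Apéry numbers `∑ C(n,k)² C(n+k,k)²`. -/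
noncomputable def aperyA (n : ℕ) : ℝ := ∑ k ∈ Finset.range (n + 1), aperyTerm n k ^ 2

/-- Zeilberger's certificate for the Apéry recurrence. -/
noncomputable def aperyCert (n k : ℕ) : ℝ :=
  4 * (2 * (n : ℝ) + 3) * (k * (2 * k + 1) - (2 * n + 3) ^ 2) * aperyTerm (n + 1) k ^ 2

lemma aperyTerm_step_eqs (n k : ℕ) :
    aperyTerm (n + 1) (k + 1) = aperyTerm (n + 1) k * (n + k + 2) * (n + 1 - k) / (k + 1) ^ 2 ∧
    aperyTerm n (k + 1) = aperyTerm (n + 1) k * (n - k) * (n + 1 - k) / (k + 1) ^ 2 ∧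
    aperyTerm (n + 2) (k + 1) =
      aperyTerm (n + 1) k * (n + k + 2) * (n + k + 3) / (k + 1) ^ 2 := by
  have hk : ((k : ℝ) + 1) ^ 2 ≠ 0 := by positivity
  have h1 := aperyTerm_succ_right (n + 1) k
  have h2 := aperyTerm_pred_succ n k
  have h3 := aperyTerm_succ_succ (n + 1) k
  push_cast at h1 h3
  refine ⟨?_, ?_, ?_⟩
  · rw [eq_div_iff hk]; linear_combination h1
  · rw [eq_div_iff hk]; linear_combination h2
  · rw [eq_div_iff hk]; linear_combination h3

lemma sum_aperyTerm_sq_telescope (n K : ℕ) :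
    ∑ k ∈ Finset.range (K + 1), (((n : ℝ) + 2) ^ 3 * aperyTerm (n + 2) k ^ 2
      - aperyCoeff n * aperyTerm (n + 1) k ^ 2 + ((n : ℝ) + 1) ^ 3 * aperyTerm n k ^ 2)
      = aperyCert n K := by
  induction K with
  | zero =>
    simp [aperyTerm_zero_right, aperyCert, aperyCoeff]; ring
  | succ K ih =>
    rw [Finset.sum_range_succ, ih]
    obtain ⟨h1, h2, h3⟩ := aperyTerm_step_eqs n K
    have hk : ((K : ℝ) + 1) ≠ 0 := by positivity
    unfold aperyCert aperyCoeff
    rw [h1, h2, h3]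
    push_cast
    field_simp
    ring

lemma aperyA_eq_sum_range {n N : ℕ} (h : n < N) :
    aperyA n = ∑ k ∈ Finset.range N, aperyTerm n k ^ 2 := by
  unfold aperyA
  refine Finset.sum_subset (fun x hx => ?_) (fun x _ hx => ?_)
  · simp at hx ⊢; omega
  · rw [aperyTerm_eq_zero (by simpa using hx)]; simp

lemma aperyA_recurrence (n : ℕ) :
    ((n : ℝ) + 2) ^ 3 * aperyA (n + 2) =
      aperyCoeff n * aperyA (n + 1) - ((n : ℝ) + 1) ^ 3 * aperyA n := by
  have h := sum_aperyTerm_sq_telescope n (n + 2)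
  rw [aperyCert, aperyTerm_eq_zero (show n + 1 < n + 2 by omega), Finset.sum_add_distrib,
    Finset.sum_sub_distrib, ← Finset.mul_sum, ← Finset.mul_sum, ← Finset.mul_sum,
    ← aperyA_eq_sum_range (by omega), ← aperyA_eq_sum_range (by omega),
    ← aperyA_eq_sum_range (by omega)] at h
  linarith

/-- Apéry's double-indexed approximations to `ζ(3)`. -/
noncomputable def aperyC (n k : ℕ) : ℝ :=
  ∑ m ∈ Finset.range n, 1 / ((m : ℝ) + 1) ^ 3 +
    ∑ m ∈ Finset.range k, (-1) ^ m / (2 * ((m : ℝ) + 1) ^ 3 * aperyTerm n (m + 1))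

lemma aperyC_succ_right (n k : ℕ) :
    aperyC n (k + 1) = aperyC n k + (-1) ^ k / (2 * ((k : ℝ) + 1) ^ 3 * aperyTerm n (k + 1)) := by
  simp only [aperyC, Finset.sum_range_succ]; ring

lemma aperyC_succ_left {n k : ℕ} (h : k ≤ n) :
    aperyC (n + 1) k = aperyC n k +
      (-1) ^ k / (((n : ℝ) + 1) ^ 2 * (n + 1 - k) * aperyTerm (n + 1) k) := by
  induction k with
  | zero =>
    simp only [aperyC, Finset.sum_range_succ, Finset.sum_range_zero, aperyTerm_zero_right]
    have : (n : ℝ) + 1 ≠ 0 := by positivity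
    push_cast
    field_simp
    ring
  | succ k ih =>
    obtain ⟨h1, h2, -⟩ := aperyTerm_step_eqs n k
    have hy : aperyTerm (n + 1) k ≠ 0 := (aperyTerm_pos (by omega)).ne'
    rw [aperyC_succ_right, aperyC_succ_right, ih (by omega), h1, h2]
    obtain ⟨d, rfl⟩ := Nat.exists_eq_add_of_le h
    have hk : ((k : ℝ) + 1) ≠ 0 := by positivity
    have hd : ((d : ℝ) + 1) ≠ 0 := by positivity
    have hd2 : ((d : ℝ) + 2) ≠ 0 := by positivity
    have hkd : (2 * (k : ℝ) + d + 3) ≠ 0 := by positivity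
    have hkd' : ((k : ℝ) + d + 2) ≠ 0 := by positivity
    generalize aperyTerm (k + 1 + d + 1) k = y at *
    push_cast
    rw [show (k : ℝ) + 1 + d + 1 - k = d + 2 by ring,
      show (k : ℝ) + 1 + d + k + 2 = 2 * k + d + 3 by ring, show (k : ℝ) + 1 + d - k = d + 1 by ring,
      show (k : ℝ) + 1 + d + 1 - (k + 1) = d + 1 by ring,
      show (k : ℝ) + 1 + d + 1 = k + d + 2 by ring, pow_succ]
    field_simp
    ring

/-- The numerators of Apéry's approximations to `ζ(3)`. -/
noncomputable def aperyB (n : ℕ) : ℝ :=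
  ∑ k ∈ Finset.range (n + 1), aperyTerm n k ^ 2 * aperyC n k

/-- The certificate for the recurrence satisfied by `aperyB`. -/
noncomputable def aperyCertB (n k : ℕ) : ℝ :=
  aperyCert n k * aperyC (n + 1) k
    - 5 * (2 * (n : ℝ) + 3) * (-1) ^ k * k / ((n + 1) * (n + 2)) * aperyTerm (n + 1) k

lemma aperyB_summand_eq {n k : ℕ} (h : k ≤ n) :
    ((n : ℝ) + 2) ^ 3 * (aperyTerm (n + 2) (k + 1) ^ 2 * aperyC (n + 2) (k + 1))
      - aperyCoeff n * (aperyTerm (n + 1) (k + 1) ^ 2 * aperyC (n + 1) (k + 1))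
      + ((n : ℝ) + 1) ^ 3 * (aperyTerm n (k + 1) ^ 2 * aperyC n (k + 1))
      = aperyCertB n (k + 1) - aperyCertB n k := by
  obtain ⟨h1, h2, h3⟩ := aperyTerm_step_eqs n k
  have hy : aperyTerm (n + 1) k ≠ 0 := (aperyTerm_pos (by omega)).ne'
  have hy2 : aperyTerm (n + 1) (k + 1) ≠ 0 := (aperyTerm_pos (by omega)).ne'
  have hc2 : aperyC (n + 2) (k + 1) = aperyC (n + 1) (k + 1) + _ :=
    aperyC_succ_left (show k + 1 ≤ n + 1 by omega)
  have hc0 : aperyTerm n (k + 1) ^ 2 * aperyC n (k + 1) = aperyTerm n (k + 1) ^ 2 *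
      aperyC (n + 1) (k + 1) - aperyTerm n (k + 1) * ((-1) ^ (k + 1) / (((n : ℝ) + 1) ^ 2 *
        (n + k + 2))) := by
    rcases Nat.lt_or_ge k n with hkn | hkn
    · rw [aperyC_succ_left (show k + 1 ≤ n by omega)]
      have e := aperyTerm_succ_left n (k + 1)
      have : ((n : ℝ) + k + 2) ≠ 0 := by positivity
      have hnk : ((n : ℝ) - k) ≠ 0 := by
        have : (k : ℝ) < n := by exact_mod_cast hkn
        linarith
      push_cast at e ⊢
      rw [show (n : ℝ) + 1 - (k + 1) = n - k by ring] at *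
      have e' : aperyTerm n (k + 1) = aperyTerm (n + 1) (k + 1) * (n - k) / (n + k + 2) := by
        rw [eq_div_iff this]; linear_combination -e
      rw [e']
      field_simp
      ring
    · rw [aperyTerm_eq_zero (show n < k + 1 by omega)]; ring
  rw [hc0, hc2]
  unfold aperyCertB aperyCert aperyCoeff
  rw [aperyC_succ_right, show n + 1 + 1 = n + 2 from rfl]
  rw [h1, h2, h3]
  generalize aperyC (n + 1) k = c
  obtain ⟨d, rfl⟩ := Nat.exists_eq_add_of_le h
  generalize aperyTerm (k + d + 1) k = y at *
  have hk : ((k : ℝ) + 1) ≠ 0 := by positivity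
  have hd : ((d : ℝ) + 1) ≠ 0 := by positivity
  have hkd : (2 * (k : ℝ) + d + 2) ≠ 0 := by positivity
  have hkd3 : (2 * (k : ℝ) + d + 3) ≠ 0 := by positivity
  have hkd' : ((k : ℝ) + d + 2) ≠ 0 := by positivity
  have hkd1 : ((k : ℝ) + d + 1) ≠ 0 := by positivity
  push_cast
  rw [show (k : ℝ) + d + 1 - k = d + 1 by ring, show (k : ℝ) + d - k = d by ring,
      show (k : ℝ) + d + k + 2 = 2 * k + d + 2 by ring,
      show (k : ℝ) + d + k + 3 = 2 * k + d + 3 by ring,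
      show (k : ℝ) + d + 1 + 1 - (k + 1) = d + 1 by ring,
      show (k : ℝ) + d + 1 + 1 = k + d + 2 by ring, pow_succ]
  field_simp
  ring

lemma sum_aperyB_telescope {n K : ℕ} (h : K ≤ n + 1) :
    ∑ k ∈ Finset.range (K + 1), (((n : ℝ) + 2) ^ 3 * (aperyTerm (n + 2) k ^ 2 * aperyC (n + 2) k)
      - aperyCoeff n * (aperyTerm (n + 1) k ^ 2 * aperyC (n + 1) k)
      + ((n : ℝ) + 1) ^ 3 * (aperyTerm n k ^ 2 * aperyC n k)) = aperyCertB n K := by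
  induction K with
  | zero =>
    have h2 := aperyC_succ_left (Nat.zero_le (n + 1))
    have h1 := aperyC_succ_left (Nat.zero_le n)
    have e2 : (n : ℝ) + 2 ≠ 0 := by positivity
    have e1 : (n : ℝ) + 1 ≠ 0 := by positivity
    simp only [aperyTerm_zero_right, aperyCertB, aperyCert, aperyCoeff, zero_add,
      Finset.sum_range_one] at *
    rw [show n + 1 + 1 = n + 2 from rfl] at h2
    rw [h2, h1]
    push_cast
    rw [show (n : ℝ) + 1 + 1 = n + 2 by ring, sub_zero, sub_zero]
    field_simp
    ring
  | succ K ih =>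
    rw [Finset.sum_range_succ, ih (by omega), aperyB_summand_eq (by omega)]
    ring

lemma aperyB_eq_sum_range {n N : ℕ} (h : n < N) :
    aperyB n = ∑ k ∈ Finset.range N, aperyTerm n k ^ 2 * aperyC n k := by
  unfold aperyB
  refine Finset.sum_subset (fun x hx => ?_) (fun x _ hx => ?_)
  · simp at hx ⊢; omega
  · rw [aperyTerm_eq_zero (by simpa using hx)]; simp

lemma aperyB_recurrence (n : ℕ) :
    ((n : ℝ) + 2) ^ 3 * aperyB (n + 2) =
      aperyCoeff n * aperyB (n + 1) - ((n : ℝ) + 1) ^ 3 * aperyB n := by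
  have h := sum_aperyB_telescope (le_refl (n + 1))
  rw [Finset.sum_add_distrib,
    Finset.sum_sub_distrib, ← Finset.mul_sum, ← Finset.mul_sum, ← Finset.mul_sum,
    ← aperyB_eq_sum_range (show n + 1 < n + 1 + 1 by omega),
    ← aperyB_eq_sum_range (show n < n + 1 + 1 by omega)] at h
  have hB : aperyB (n + 2) = _ := Finset.sum_range_succ _ _
  rw [hB, mul_add]
  have key : ((n : ℝ) + 2) ^ 3 * (aperyTerm (n + 2) (n + 2) ^ 2 * aperyC (n + 2) (n + 2)) =
      - aperyCertB n (n + 1) := by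
    have e := aperyTerm_succ_succ (n + 1) (n + 1)
    have hy : aperyTerm (n + 1) (n + 1) ≠ 0 := (aperyTerm_pos le_rfl).ne'
    have hc : aperyC (n + 2) (n + 1) = _ := aperyC_succ_left (le_refl (n + 1))
    have hT := aperyTerm_succ_left (n + 1) (n + 1)
    have e2 : (n : ℝ) + 2 ≠ 0 := by positivity
    have e1 : (n : ℝ) + 1 ≠ 0 := by positivity
    have e3 : 2 * (n : ℝ) + 3 ≠ 0 := by positivity
    push_cast at e hT
    have e' : aperyTerm (n + 2) (n + 2) = aperyTerm (n + 1) (n + 1) * (2 * n + 3) * 2 / (n + 2) := by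
      rw [eq_div_iff e2]
      refine mul_right_cancel₀ e2 ?_
      linear_combination e
    have hT' : aperyTerm (n + 2) (n + 1) = aperyTerm (n + 1) (n + 1) * (2 * n + 3) := by
      linear_combination hT
    rw [show n + 1 + 1 = n + 2 from rfl, hT'] at hc
    rw [aperyC_succ_right (n + 2) (n + 1), hc, show n + 1 + 1 = n + 2 from rfl, e']
    unfold aperyCertB aperyCert
    generalize aperyTerm (n + 1) (n + 1) = y at *
    push_cast
    rw [show (n : ℝ) + 1 + 1 - (n + 1) = 1 by ring, show (n : ℝ) + 1 + 1 = n + 2 by ring]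
    field_simp
    ring
  linarith

lemma aperyA_pos (n : ℕ) : 0 < aperyA n :=
  Finset.sum_pos (fun _ hk => pow_pos (aperyTerm_pos (by simpa [Nat.lt_succ_iff] using hk)) 2)
    (by simp)

lemma le_aperyTerm {n k : ℕ} (h : k < n) : (n : ℝ) + 1 ≤ aperyTerm n (k + 1) := by
  have h1 : 1 ≤ n.choose (k + 1) := Nat.choose_pos (by omega)
  have h2 : n + 1 ≤ (n + (k + 1)).choose (k + 1) := by
    have h4 : (n + (k + 1)).choose n = (n + (k + 1)).choose (k + 1) := Nat.choose_symm_add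
    have h3 : (n + 1).choose n ≤ (n + (k + 1)).choose n := Nat.choose_le_choose n (by omega)
    rw [← h4]
    simpa using h3
  have h3 : n + 1 ≤ n.choose (k + 1) * (n + (k + 1)).choose (k + 1) := by nlinarith
  unfold aperyTerm
  exact_mod_cast h3

lemma summable_inv_cube : Summable (fun k : ℕ => 1 / ((k : ℝ) + 1) ^ 3) := by
  have := (summable_nat_add_iff 1).2 (Real.summable_one_div_nat_pow.2 (show 1 < 3 by norm_num))
  simpa using this

lemma abs_aperyC_sub_le {n k : ℕ} (h : k ≤ n) :
    |aperyC n k - ∑ m ∈ Finset.range n, 1 / ((m : ℝ) + 1) ^ 3| ≤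
      (∑' m : ℕ, 1 / ((m : ℝ) + 1) ^ 3) / (n + 1) := by
  rw [aperyC, add_sub_cancel_left]
  calc _ ≤ ∑ m ∈ Finset.range k, |(-1) ^ m / (2 * ((m : ℝ) + 1) ^ 3 * aperyTerm n (m + 1))| :=
        Finset.abs_sum_le_sum_abs _ _
    _ ≤ ∑ m ∈ Finset.range k, 1 / ((m : ℝ) + 1) ^ 3 / (n + 1) := by
        refine Finset.sum_le_sum fun m hm => ?_
        have hT := le_aperyTerm (show m < n by simp at hm; omega)
        have hn : (0 : ℝ) < n + 1 := by positivity
        have hT0 : 0 < aperyTerm n (m + 1) := hn.trans_le hT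
        rw [abs_div, abs_pow, abs_neg, abs_one, one_pow, abs_of_pos (by positivity), div_div]
        refine one_div_le_one_div_of_le (by positivity) ?_
        have : (0 : ℝ) < ((m : ℝ) + 1) ^ 3 := by positivity
        nlinarith [mul_le_mul_of_nonneg_left hT this.le, mul_pos this hT0]
    _ ≤ _ := by
        rw [← Finset.sum_div]
        gcongr
        exact summable_inv_cube.sum_le_tsum _ (fun _ _ => by positivity)

lemma abs_aperyB_sub_le (n : ℕ) :
    |aperyB n - aperyA n * ∑ m ∈ Finset.range n, 1 / ((m : ℝ) + 1) ^ 3| ≤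
      aperyA n * ((∑' m : ℕ, 1 / ((m : ℝ) + 1) ^ 3) / (n + 1)) := by
  rw [aperyB, aperyA, Finset.sum_mul, Finset.sum_mul, ← Finset.sum_sub_distrib]
  refine (Finset.abs_sum_le_sum_abs _ _).trans (Finset.sum_le_sum fun k hk => ?_)
  rw [← mul_sub, abs_mul, abs_of_nonneg (sq_nonneg _)]
  gcongr
  exact abs_aperyC_sub_le (by simp at hk; omega)

lemma tendsto_aperyB_div_aperyA :
    Tendsto (fun n => aperyB n / aperyA n) atTop (nhds (∑' k : ℕ, 1 / ((k : ℝ) + 1) ^ 3)) := by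
  set Z := ∑' k : ℕ, 1 / ((k : ℝ) + 1) ^ 3
  have h1 : Tendsto (fun n => ∑ m ∈ Finset.range n, 1 / ((m : ℝ) + 1) ^ 3) atTop (nhds Z) :=
    summable_inv_cube.hasSum.tendsto_sum_nat
  have h2 : Tendsto (fun n : ℕ => Z / ((n : ℝ) + 1)) atTop (nhds 0) :=
    tendsto_const_nhds.div_atTop (tendsto_atTop_add_const_right _ _ tendsto_natCast_atTop_atTop)
  have h3 : Tendsto (fun n => aperyB n / aperyA n -
      ∑ m ∈ Finset.range n, 1 / ((m : ℝ) + 1) ^ 3) atTop (nhds 0) := by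
    refine squeeze_zero_norm (fun n => ?_) h2
    have hA := aperyA_pos n
    rw [Real.norm_eq_abs, div_sub' hA.ne', abs_div, abs_of_pos hA, div_le_iff₀ hA, mul_comm _ (aperyA n)]
    exact abs_aperyB_sub_le n
  simpa using h3.add h1

lemma eq_factorial_cube_mul {u v : ℕ → ℝ}
    (hu : ∀ n : ℕ, 2 ≤ n →
      u n = (2 * (n : ℝ) - 1) * (17 * (n : ℝ) ^ 2 - 17 * (n : ℝ) + 5) * u (n - 1)
              - ((n : ℝ) - 1) ^ 6 * u (n - 2))
    (hv : ∀ n : ℕ, ((n : ℝ) + 2) ^ 3 * v (n + 2) =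
      aperyCoeff n * v (n + 1) - ((n : ℝ) + 1) ^ 3 * v n)
    (h0 : u 0 = v 0) (h1 : u 1 = v 1) (n : ℕ) : u n = (n.factorial : ℝ) ^ 3 * v n := by
  induction n using Nat.twoStepInduction with
  | zero => simpa using h0
  | one => simpa using h1
  | more n ih0 ih1 =>
    have h := hu (n + 2) (by omega)
    rw [show n + 2 - 1 = n + 1 by omega, show n + 2 - 2 = n by omega, ih0, ih1] at h
    rw [h, Nat.factorial_succ (n + 1), Nat.factorial_succ n]
    have := hv n
    unfold aperyCoeff at this
    push_cast at this ⊢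
    linear_combination (-(((n : ℝ) + 1) ^ 3) * (n.factorial : ℝ) ^ 3) * this

lemma aperyA_zero : aperyA 0 = 1 := by simp [aperyA, aperyTerm]
lemma aperyA_one : aperyA 1 = 5 := by
  norm_num [aperyA, aperyTerm, Finset.sum_range_succ]
lemma aperyB_zero : aperyB 0 = 0 := by simp [aperyB, aperyC]
lemma aperyB_one : aperyB 1 = 6 := by
  norm_num [aperyB, aperyC, aperyTerm, Finset.sum_range_succ]

lemma apery_casoratian (n : ℕ) :
    ((n : ℝ) + 1) ^ 3 * (aperyB (n + 1) * aperyA n - aperyB n * aperyA (n + 1)) = 6 := by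
  induction n with
  | zero => simp [aperyA_zero, aperyA_one, aperyB_zero, aperyB_one]
  | succ n ih =>
    have hA := aperyA_recurrence n
    have hB := aperyB_recurrence n
    push_cast
    rw [show n + 1 + 1 = n + 2 from rfl]
    linear_combination ih + aperyA (n + 1) * hB - aperyB (n + 1) * hA

/-- Stolz–Cesàro for a null sequence with geometrically decaying differences. -/
lemma tendsto_div_pow_of_tendsto_sub_div_pow {e : ℕ → ℝ} {β D : ℝ} (hβ0 : 0 < β) (hβ1 : β < 1)
    (he : Tendsto e atTop (nhds 0))
    (hd : Tendsto (fun n => (e n - e (n + 1)) / β ^ n) atTop (nhds D)) :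
    Tendsto (fun n => e n / β ^ n) atTop (nhds (D / (1 - β))) := by
  have hb : 0 < 1 - β := by linarith
  have hpow : Tendsto (fun n : ℕ => β ^ n) atTop (nhds 0) :=
    tendsto_pow_atTop_nhds_zero_of_lt_one hβ0.le hβ1
  have upper : ∀ f : ℕ → ℝ, ∀ K : ℝ, Tendsto f atTop (nhds 0) → ∀ N : ℕ,
      (∀ n ≥ N, (f n - f (n + 1)) / β ^ n ≤ K * (1 - β)) → ∀ n ≥ N, f n / β ^ n ≤ K := by
    intro f K hf N h n hn
    have hmono : Monotone (fun j => f (n + j) - K * β ^ (n + j)) := by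
      refine monotone_nat_of_le_succ fun j => ?_
      have := h (n + j) (by omega)
      rw [div_le_iff₀ (by positivity)] at this
      rw [← add_assoc, pow_succ]
      linarith
    have hlim : Tendsto (fun j => f (n + j) - K * β ^ (n + j)) atTop (nhds 0) := by
      have := (hf.sub (hpow.const_mul K)).comp (tendsto_add_atTop_nat n)
      simpa [Function.comp_def, add_comm] using this
    have := hmono.ge_of_tendsto hlim 0
    rw [div_le_iff₀ (by positivity)]
    simpa using this
  rw [Metric.tendsto_atTop] at hd ⊢
  intro ε hε
  obtain ⟨N, hN⟩ := hd (ε / 2 * (1 - β)) (by positivity)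
  refine ⟨N, fun n hn => ?_⟩
  have h1 := upper e (D / (1 - β) + ε / 2) he N (fun m hm => by
    have := abs_lt.1 (Real.dist_eq _ _ ▸ hN m hm)
    rw [add_mul, div_mul_cancel₀ _ hb.ne']
    linarith) n hn
  have h2 := upper (fun n => - e n) (-(D / (1 - β)) + ε / 2) (by simpa using he.neg) N (fun m hm => by
    have := abs_lt.1 (Real.dist_eq _ _ ▸ hN m hm)
    rw [add_mul, neg_mul, div_mul_cancel₀ _ hb.ne', ← neg_sub', neg_div]
    linarith) n hn
  rw [Real.dist_eq, abs_lt]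
  rw [neg_div] at h2
  constructor <;> linarith

/-- The exponential growth rate of `aperyTerm n k` at `x = k / n`. -/
noncomputable def aperyRate (x : ℝ) : ℝ :=
  (1 + x) * log (1 + x) - 2 * (x * log x) - (1 - x) * log (1 - x)

lemma continuous_aperyRate : Continuous aperyRate := by
  have h := Real.continuous_mul_log
  have h1 : Continuous fun x : ℝ => (1 + x) * log (1 + x) :=
    h.comp (continuous_const.add continuous_id)
  have h2 : Continuous fun x : ℝ => (1 - x) * log (1 - x) :=
    h.comp (continuous_const.sub continuous_id)
  exact (h1.sub (h.const_mul 2)).sub h2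

lemma hasDerivAt_aperyRate {x : ℝ} (h0 : 0 < x) (h1 : x < 1) :
    HasDerivAt aperyRate (log ((1 - x ^ 2) / x ^ 2)) x := by
  have ha : HasDerivAt (fun y : ℝ => 1 + y) 1 x := (hasDerivAt_id x).const_add 1
  have hs : HasDerivAt (fun y : ℝ => 1 - y) (-1) x := (hasDerivAt_id x).const_sub 1
  have e1 := (Real.hasDerivAt_mul_log (show 1 + x ≠ 0 by linarith)).comp x ha
  have e2 := (Real.hasDerivAt_mul_log h0.ne').const_mul 2
  have e3 := (Real.hasDerivAt_mul_log (show 1 - x ≠ 0 by linarith)).comp x hs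
  refine ((e1.sub e2).sub e3).congr_deriv ?_
  rw [show 1 - x ^ 2 = (1 + x) * (1 - x) by ring, log_div (by nlinarith) (by positivity),
    log_mul (by linarith) (by linarith), log_pow]
  push_cast
  ring

lemma inv_sqrt_two_sq : (1 / √2 : ℝ) ^ 2 = 1 / 2 := by
  rw [div_pow, Real.sq_sqrt (by norm_num)]; norm_num

lemma inv_sqrt_two_mem : (0.7 : ℝ) < 1 / √2 ∧ 1 / √2 < (0.71 : ℝ) := by
  have h := inv_sqrt_two_sq
  have h0 : (0 : ℝ) < 1 / √2 := by positivity
  constructor <;> nlinarith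

lemma aperyRate_inv_sqrt_two : aperyRate (1 / √2) = 2 * log (1 + √2) := by
  obtain ⟨ha, hb⟩ := inv_sqrt_two_mem
  have h2 := Real.sq_sqrt (show (0 : ℝ) ≤ 2 by norm_num)
  have hs : (0 : ℝ) < √2 := by positivity
  have hs1 : 1 < √2 := by nlinarith
  have e1 : 1 + 1 / √2 = (1 + √2) / √2 := by field_simp; ring
  have e2 : 1 - 1 / √2 = 1 / ((1 + √2) * √2) := by
    field_simp
    nlinarith
  rw [aperyRate, e2, e1, log_div (by positivity) (by positivity), log_div (by norm_num) (by positivity),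
    log_div (by norm_num) (by positivity), log_mul (by positivity) (by positivity), log_one]
  have hx : 1 / ((1 + √2) * √2) = 1 - 1 / √2 := e2.symm
  rw [hx, show (1 + √2) / √2 = 1 + 1 / √2 from e1.symm]
  ring

lemma aperyRate_le {x : ℝ} (h0 : 0 ≤ x) (h1 : x ≤ 1) :
    aperyRate x ≤ aperyRate (1 / √2) - (x - 1 / √2) ^ 2 / 2 := by
  obtain ⟨ha, hb⟩ := inv_sqrt_two_mem
  have hsq := inv_sqrt_two_sq
  set s := 1 / √2
  let G : ℝ → ℝ := fun y => aperyRate y + (y - s) ^ 2 / 2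
  have hG : Continuous G := by
    have := continuous_aperyRate
    fun_prop
  have hd : ∀ y, 0 < y → y < 1 → HasDerivAt G (log ((1 - y ^ 2) / y ^ 2) + (y - s)) y := by
    intro y hy0 hy1
    refine ((hasDerivAt_aperyRate hy0 hy1).add
      ((((hasDerivAt_id y).sub_const s).pow 2).div_const 2)).congr_deriv ?_
    simp
  suffices G x ≤ G s by simp [G] at this; linarith
  rcases le_total x s with hxs | hxs
  · have : MonotoneOn G (Set.Icc 0 s) := by
      refine monotoneOn_of_deriv_nonneg (convex_Icc _ _) hG.continuousOn ?_ ?_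
      · rw [interior_Icc]
        exact fun y hy =>
          (hd y hy.1 (by linarith [hy.2])).differentiableAt.differentiableWithinAt
      · rw [interior_Icc]
        rintro y ⟨hy0, hys⟩
        rw [(hd y hy0 (by linarith)).deriv]
        have hpos : 0 < 1 - y ^ 2 := by nlinarith
        have hl := Real.one_sub_inv_le_log_of_pos (x := (1 - y ^ 2) / y ^ 2) (by positivity)
        have : s - y ≤ 1 - ((1 - y ^ 2) / y ^ 2)⁻¹ := by
          rw [inv_div, one_sub_div hpos.ne', le_div_iff₀ hpos]
          nlinarith [mul_nonneg (sub_nonneg.2 hys.le) (show 0 ≤ 2 * (s + y) - (1 - y ^ 2) by nlinarith)]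
        linarith
    exact this ⟨h0, hxs⟩ ⟨by linarith, le_rfl⟩ hxs
  · have : AntitoneOn G (Set.Icc s 1) := by
      refine antitoneOn_of_deriv_nonpos (convex_Icc _ _) hG.continuousOn ?_ ?_
      · rw [interior_Icc]
        exact fun y hy =>
          (hd y (by linarith [hy.1]) hy.2).differentiableAt.differentiableWithinAt
      · rw [interior_Icc]
        rintro y ⟨hys, hy1⟩
        have hy0 : 0 < y := by linarith
        rw [(hd y hy0 hy1).deriv]
        have hpos : 0 < 1 - y ^ 2 := by nlinarith
        have hl := Real.log_le_sub_one_of_pos (x := (1 - y ^ 2) / y ^ 2) (by positivity)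
        have : (1 - y ^ 2) / y ^ 2 - 1 ≤ s - y := by
          rw [div_sub_one (by positivity), div_le_iff₀ (by positivity)]
          nlinarith [mul_nonneg (sub_nonneg.2 hys.le) (show 0 ≤ 2 * (s + y) - y ^ 2 by nlinarith)]
        linarith
    exact this ⟨le_rfl, by linarith⟩ ⟨hxs, h1⟩ hxs

lemma tendsto_aperyRate_quotient :
    Tendsto (fun x => (aperyRate x - aperyRate (1 / √2)) / (x - 1 / √2) ^ 2)
      (nhdsWithin (1 / √2) {1 / √2}ᶜ) (nhds (-(2 * √2))) := by
  obtain ⟨ha, hb⟩ := inv_sqrt_two_mem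
  have hsq := inv_sqrt_two_sq
  have h4 : (4 : ℝ) * √2 = 4 / (1 / √2) := by field_simp
  set s := 1 / √2
  have hs0 : 0 < s := by linarith
  have hnear : ∀ᶠ y in nhdsWithin s {s}ᶜ, 0 < y ∧ y < 1 :=
    nhdsWithin_le_nhds (Ioo_mem_nhds hs0 (by linarith))
  refine HasDerivAt.lhopital_zero_nhdsNE (f' := fun y => log ((1 - y ^ 2) / y ^ 2))
    (g' := fun y => 2 * (y - s)) ?_ ?_ ?_ ?_ ?_ ?_
  · filter_upwards [hnear] with y hy
    exact (hasDerivAt_aperyRate hy.1 hy.2).sub_const _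
  · refine Eventually.of_forall fun y => ?_
    refine (((hasDerivAt_id y).sub_const s).pow 2).congr_deriv ?_
    simp
  · filter_upwards [self_mem_nhdsWithin] with y hy
    simpa [sub_eq_zero] using hy
  · have := (continuous_aperyRate.sub (continuous_const (y := aperyRate s))).tendsto s
    rw [Pi.sub_apply, sub_self] at this
    exact this.mono_left nhdsWithin_le_nhds
  · have : Continuous fun y : ℝ => (y - s) ^ 2 := by fun_prop
    have := this.tendsto s
    simp only [sub_self, ne_eq, OfNat.ofNat_ne_zero, not_false_eq_true, zero_pow] at this
    exact this.mono_left nhdsWithin_le_nhds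
  · have hz : (1 - s ^ 2) / s ^ 2 = 1 := by rw [hsq]; norm_num
    have hlog : HasDerivAt (fun y : ℝ => log ((1 - y ^ 2) / y ^ 2)) (-(4 * √2)) s := by
      have h1 : HasDerivAt (fun y : ℝ => y ^ 2) (2 * s) s := by simpa using hasDerivAt_pow 2 s
      have h2 := ((h1.const_sub 1).div h1 (by positivity)).log (by
        simp only [Pi.div_apply]; rw [hz]; norm_num)
      refine h2.congr_deriv ?_
      simp only [Pi.div_apply]
      rw [hz, h4, hsq]
      field_simp
      nlinarith
    have h5 := hasDerivAt_iff_tendsto_slope.1 hlog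
    have h6 := h5.div_const 2
    rw [show -(4 * √2) / 2 = -(2 * √2) by ring] at h6
    refine h6.congr fun y => ?_
    rw [slope_def_field, hz, log_one, sub_zero, div_div, mul_comm]

lemma tendsto_mul_aperyRate_sub {ι : Type*} {l : Filter ι} {x w : ι → ℝ} {T : ℝ}
    (hx : Tendsto x l (nhds (1 / √2)))
    (hw : Tendsto (fun i => w i * (x i - 1 / √2) ^ 2) l (nhds T)) :
    Tendsto (fun i => w i * (aperyRate (x i) - aperyRate (1 / √2))) l
      (nhds (-(2 * √2) * T)) := by
  let ψ := Function.update (fun x => (aperyRate x - aperyRate (1 / √2)) / (x - 1 / √2) ^ 2)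
    (1 / √2) (-(2 * √2))
  have hψ : ContinuousAt ψ (1 / √2) :=
    continuousAt_update_same.2 tendsto_aperyRate_quotient
  have hψ' : ψ (1 / √2) = -(2 * √2) := Function.update_self ..
  have h1 : Tendsto (fun i => ψ (x i)) l (nhds (-(2 * √2))) := by
    rw [← hψ']; exact hψ.tendsto.comp hx
  refine (h1.mul hw).congr fun i => ?_
  by_cases h : x i = 1 / √2
  · simp [h]
  · have : (x i - 1 / √2) ≠ 0 := sub_ne_zero.2 h
    simp only [ψ, Function.update_of_ne h]
    rw [div_mul_eq_mul_div, div_eq_iff (pow_ne_zero 2 this)]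
    ring

lemma natCast_pow_self_eq_exp (j : ℕ) : (j : ℝ) ^ j = exp (j * log j) := by
  rcases Nat.eq_zero_or_pos j with rfl | h
  · simp
  · rw [mul_comm, exp_mul, exp_log (by exact_mod_cast h), rpow_natCast]

lemma exp_mul_aperyRate {n k : ℕ} (hn : 0 < n) (hk : k ≤ n) :
    exp (n * aperyRate (k / n)) =
      ((n + k : ℕ) : ℝ) ^ (n + k) / (((k : ℝ) ^ k) ^ 2 * ((n - k : ℕ) : ℝ) ^ (n - k)) := by
  have hn' : (n : ℝ) ≠ 0 := by positivity
  have key : ∀ j : ℕ, (j : ℝ) * log (j / n) = j * log j - j * log n := by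
    intro j
    rcases Nat.eq_zero_or_pos j with rfl | h
    · simp
    · rw [log_div (by positivity) hn']; ring
  rw [natCast_pow_self_eq_exp, natCast_pow_self_eq_exp, natCast_pow_self_eq_exp, ← exp_nat_mul,
    ← exp_add, ← exp_sub]
  congr 1
  have e1 := key (n + k)
  have e2 := key k
  have e3 := key (n - k)
  rw [aperyRate, show 1 + (k : ℝ) / n = ((n + k : ℕ) : ℝ) / n by push_cast; field_simp,
    show 1 - (k : ℝ) / n = ((n - k : ℕ) : ℝ) / n by rw [Nat.cast_sub hk]; field_simp]
  have : (n : ℝ) * (((n + k : ℕ) : ℝ) / n * log (((n + k : ℕ) : ℝ) / n) - 2 * (k / n * log (k / n))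
      - ((n - k : ℕ) : ℝ) / n * log (((n - k : ℕ) : ℝ) / n)) =
      ((n + k : ℕ) : ℝ) * log (((n + k : ℕ) : ℝ) / n) - 2 * (k * log (k / n))
      - ((n - k : ℕ) : ℝ) * log (((n - k : ℕ) : ℝ) / n) := by field_simp
  rw [this, e1, e2, e3]
  push_cast [Nat.cast_sub hk]
  ring

lemma choose_mul_pow_le (n k : ℕ) :
    (n + k).choose k * (k ^ k * n ^ n) ≤ (n + k) ^ (n + k) := by
  rw [add_comm n k, add_pow]
  have := Finset.single_le_sum (f := fun m => k ^ m * n ^ (k + n - m) * (k + n).choose m)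
    (fun _ _ => Nat.zero_le _) (Finset.mem_range.2 (show k < k + n + 1 by omega))
  simp only [Nat.add_sub_cancel_left] at this
  simpa [mul_comm] using this

lemma aperyTerm_le_exp {n k : ℕ} (hn : 0 < n) (hk : k ≤ n) :
    aperyTerm n k ≤ exp (n * aperyRate (k / n)) := by
  rw [exp_mul_aperyRate hn hk]
  obtain ⟨d, rfl⟩ := Nat.exists_eq_add_of_le hk
  have h1 := choose_mul_pow_le d k
  have h2 := choose_mul_pow_le (k + d) k
  have hp : ∀ j : ℕ, (0 : ℝ) < (j : ℝ) ^ j := fun j => by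
    rw [natCast_pow_self_eq_exp]; positivity
  rw [add_comm d k] at h1
  have h1' : ((k + d).choose k : ℝ) * ((k : ℝ) ^ k * (d : ℝ) ^ d) ≤ ((k + d : ℕ) : ℝ) ^ (k + d) := by
    exact_mod_cast h1
  have h2' : ((k + d + k).choose k : ℝ) * ((k : ℝ) ^ k * ((k + d : ℕ) : ℝ) ^ (k + d)) ≤
      ((k + d + k : ℕ) : ℝ) ^ (k + d + k) := by
    exact_mod_cast h2
  have hk' := hp k
  have hd' := hp d
  rw [Nat.add_sub_cancel_left, le_div_iff₀ (by positivity), aperyTerm]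
  refine le_trans ?_ h2'
  have := mul_le_mul_of_nonneg_left h1'
    (show (0 : ℝ) ≤ (k + d + k).choose k * (k : ℝ) ^ k by positivity)
  linarith

lemma factorial_eq_stirlingSeq {j : ℕ} (hj : 0 < j) :
    (j.factorial : ℝ) = Stirling.stirlingSeq j * √(2 * j) * ((j : ℝ) ^ j / exp j) := by
  rw [Stirling.stirlingSeq, div_pow, ← exp_nat_mul, mul_one]
  field_simp

lemma aperyTerm_eq_factorial {n k : ℕ} (hk : k ≤ n) :
    aperyTerm n k = ((n + k).factorial : ℝ) / ((k.factorial : ℝ) ^ 2 * (n - k).factorial) := by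
  rw [aperyTerm, Nat.cast_choose ℝ hk, Nat.cast_choose ℝ (Nat.le_add_left k n),
    Nat.add_sub_cancel]
  field_simp

lemma aperyTerm_eq_stirling {n k : ℕ} (h0 : 0 < k) (hk : k < n) :
    n * aperyTerm n k = Stirling.stirlingSeq (n + k) /
        (Stirling.stirlingSeq k ^ 2 * Stirling.stirlingSeq (n - k)) *
      (√((1 + k / n) / (1 - k / n)) / (2 * (k / n))) * exp (n * aperyRate (k / n)) := by
  have hn : 0 < n := by omega
  rw [exp_mul_aperyRate hn hk.le, aperyTerm_eq_factorial hk.le, factorial_eq_stirlingSeq h0,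
    factorial_eq_stirlingSeq (show 0 < n + k by omega),
    factorial_eq_stirlingSeq (show 0 < n - k by omega)]
  obtain ⟨d, rfl⟩ := Nat.exists_eq_add_of_lt hk
  rw [show k + d + 1 - k = d + 1 by omega]
  have hs1 : Stirling.stirlingSeq k ≠ 0 := by
    obtain ⟨j, rfl⟩ := Nat.exists_eq_succ_of_ne_zero h0.ne'
    exact (Stirling.stirlingSeq'_pos j).ne'
  have hs2 := (Stirling.stirlingSeq'_pos d).ne'
  have e : (1 + (k : ℝ) / ((k + d + 1 : ℕ) : ℝ)) / (1 - (k : ℝ) / ((k + d + 1 : ℕ) : ℝ)) =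
      (2 * ((k + d + 1 + k : ℕ) : ℝ)) / (2 * ((d + 1 : ℕ) : ℝ)) := by
    push_cast
    have : (1 : ℝ) - k / (k + d + 1) = (d + 1) / (k + d + 1) := by field_simp; ring
    rw [this]
    field_simp
  have hexp : exp ((k + d + 1 + k : ℕ) : ℝ) = exp k ^ 2 * exp ((d + 1 : ℕ) : ℝ) := by
    rw [← exp_nat_mul, ← exp_add]; congr 1; push_cast; ring
  rw [e, Real.sqrt_div (by positivity), hexp]
  have hk' : (0 : ℝ) < k := by exact_mod_cast h0
  have hsk : √(2 * (k : ℝ)) ^ 2 = 2 * k := Real.sq_sqrt (by positivity)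
  rw [mul_pow, mul_pow, hsk]
  have hd' : √(2 * ((d + 1 : ℕ) : ℝ)) ≠ 0 := by positivity
  have hp1 : (k : ℝ) ^ k ≠ 0 := by positivity
  have hp2 : ((d + 1 : ℕ) : ℝ) ^ (d + 1) ≠ 0 := by positivity
  field_simp

/-- The squared Apéry term normalised by `n² (1+√2)^(-4n)`. -/
noncomputable def aperyWeight (n k : ℕ) : ℝ :=
  (n * aperyTerm n k * exp (-(n * aperyRate (1 / √2)))) ^ 2

lemma stirlingSeq_le_two {n : ℕ} (hn : 0 < n) : Stirling.stirlingSeq n ≤ 2 := by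
  obtain ⟨j, rfl⟩ := Nat.exists_eq_succ_of_ne_zero hn.ne'
  have h : Stirling.stirlingSeq (j + 1) ≤ Stirling.stirlingSeq 1 :=
    Stirling.stirlingSeq'_antitone (Nat.zero_le j)
  refine h.trans ?_
  rw [Stirling.stirlingSeq_one, div_le_iff₀ (by positivity)]
  have h1 := inv_sqrt_two_mem
  have h2 : √2 * (1 / √2) = 1 := by field_simp
  have h3 := Real.exp_one_lt_d9
  nlinarith [h1.2, Real.sqrt_nonneg 2]

lemma one_le_stirlingSeq {n : ℕ} (hn : 0 < n) : 1 ≤ Stirling.stirlingSeq n := by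
  refine le_trans ?_ (Stirling.sqrt_pi_le_stirlingSeq hn.ne')
  rw [Real.one_le_sqrt]
  linarith [Real.pi_gt_three]

lemma mul_aperyTerm_le {n k : ℕ} (hn : 0 < n) (hk : k ≤ n) :
    n * aperyTerm n k ≤ 400 * exp (n * aperyRate (1 / √2)) *
      exp (-(n * (k / n - 1 / √2) ^ 2 / 4)) := by
  obtain ⟨ha, hb⟩ := inv_sqrt_two_mem
  have hn' : (0 : ℝ) < n := by exact_mod_cast hn
  have hx0 : 0 ≤ (k : ℝ) / n := by positivity
  have hx1 : (k : ℝ) / n ≤ 1 := by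
    rw [div_le_one hn']; exact_mod_cast hk
  have hrate := aperyRate_le hx0 hx1
  have hexp : exp (n * aperyRate (k / n)) ≤ exp (n * aperyRate (1 / √2)) *
      exp (-(n * (k / n - 1 / √2) ^ 2 / 2)) := by
    rw [← exp_add, exp_le_exp]
    nlinarith
  set s := 1 / √2
  set v := (n : ℝ) * (k / n - s) ^ 2 with hv
  have hv0 : 0 ≤ v := by positivity
  have hexp2 : exp (-(v / 2)) = exp (-(v / 4)) * exp (-(v / 4)) := by
    rw [← exp_add]; congr 1; ring
  have hE : exp (-(v / 4)) ≤ 1 := by rw [exp_le_one_iff]; linarith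
  by_cases hc : |(k : ℝ) / n - s| ≤ 1 / 10
  · obtain ⟨h1, h2⟩ := abs_le.1 hc
    have hxlo : 1 / 2 ≤ (k : ℝ) / n := by linarith
    have hxhi : (k : ℝ) / n ≤ 9 / 10 := by linarith
    have hk0 : 0 < k := by
      rcases Nat.eq_zero_or_pos k with rfl | h
      · norm_num at hxlo
      · exact h
    have hkn : k < n := by
      rw [div_le_iff₀ hn'] at hxhi
      have : (k : ℝ) < n := by linarith
      exact_mod_cast this
    rw [aperyTerm_eq_stirling hk0 hkn]
    have hσ : Stirling.stirlingSeq (n + k) /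
        (Stirling.stirlingSeq k ^ 2 * Stirling.stirlingSeq (n - k)) ≤ 2 := by
      have a1 := stirlingSeq_le_two (show 0 < n + k by omega)
      have a2 := one_le_stirlingSeq hk0
      have a3 := one_le_stirlingSeq (show 0 < n - k by omega)
      have a4 := one_le_mul_of_one_le_of_one_le (one_le_pow₀ a2 (n := 2)) a3
      rw [div_le_iff₀ (by linarith)]
      linarith
    have hσ0 : 0 ≤ Stirling.stirlingSeq (n + k) /
        (Stirling.stirlingSeq k ^ 2 * Stirling.stirlingSeq (n - k)) := by
      have a1 := one_le_stirlingSeq (show 0 < n + k by omega)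
      have a3 := one_le_stirlingSeq (show 0 < n - k by omega)
      positivity
    have hq : √((1 + (k : ℝ) / n) / (1 - k / n)) / (2 * (k / n)) ≤ 5 := by
      rw [div_le_iff₀ (by linarith)]
      have : √((1 + (k : ℝ) / n) / (1 - k / n)) ≤ 5 := by
        rw [Real.sqrt_le_left (by norm_num), div_le_iff₀ (by linarith)]
        linarith
      linarith
    have hq0 : 0 ≤ √((1 + (k : ℝ) / n) / (1 - k / n)) / (2 * (k / n)) := by positivity
    calc _ ≤ 2 * 5 * (exp (n * aperyRate s) * exp (-(v / 2))) := by gcongr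
      _ ≤ 400 * (exp (n * aperyRate s) * exp (-(v / 4))) := by
        rw [hexp2]
        have : 0 < exp (n * aperyRate s) * exp (-(v / 4)) := by positivity
        nlinarith
      _ = _ := by ring
  · have hT := aperyTerm_le_exp hn hk
    have hnv : (n : ℝ) ≤ 100 * v := by
      have : (1 / 10 : ℝ) ^ 2 ≤ ((k : ℝ) / n - s) ^ 2 := by
        rw [← sq_abs ((k : ℝ) / n - s)]
        exact pow_le_pow_left₀ (by norm_num) (not_le.1 hc).le 2
      nlinarith
    have hve : (n : ℝ) * exp (-(v / 4)) ≤ 400 := by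
      have h1 : v / 4 ≤ exp (v / 4) := by linarith [Real.add_one_le_exp (v / 4)]
      have h2 : exp (v / 4) * exp (-(v / 4)) = 1 := by rw [← exp_add]; simp
      have h3 : 0 < exp (-(v / 4)) := exp_pos _
      nlinarith
    calc n * aperyTerm n k ≤ n * (exp (n * aperyRate s) * exp (-(v / 2))) := by
          gcongr; exact hT.trans hexp
      _ = exp (n * aperyRate s) * exp (-(v / 4)) * (n * exp (-(v / 4))) := by rw [hexp2]; ring
      _ ≤ exp (n * aperyRate s) * exp (-(v / 4)) * 400 := by gcongr
      _ = _ := by ring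

lemma aperyWeight_le {n k : ℕ} (hn : 0 < n) :
    aperyWeight n k ≤ 160000 * exp (-(n * (k / n - 1 / √2) ^ 2 / 2)) := by
  rcases le_or_gt k n with hk | hk
  · have h := mul_aperyTerm_le hn hk
    have h0 := aperyTerm_nonneg n k
    have h1 : n * aperyTerm n k * exp (-(n * aperyRate (1 / √2))) ≤
        400 * exp (-(n * (k / n - 1 / √2) ^ 2 / 4)) := by
      rw [exp_neg, ← div_eq_mul_inv, div_le_iff₀ (exp_pos _)]
      linarith
    refine (pow_le_pow_left₀ (by positivity) h1 2).trans (le_of_eq ?_)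
    rw [mul_pow, ← exp_nat_mul]
    norm_num
    ring
  · rw [aperyWeight, aperyTerm_eq_zero hk]
    simp
    positivity

/-- The step function with value `g k` on `[k, k+1)`. -/
noncomputable def stepFun (g : ℕ → ℝ) (y : ℝ) : ℝ := if 0 ≤ y then g ⌊y⌋₊ else 0

lemma stepFun_eq_sum {g : ℕ → ℝ} {N : ℕ} (hg : ∀ k, N ≤ k → g k = 0) :
    stepFun g = fun y => ∑ k ∈ Finset.range N,
      (Set.Ico (k : ℝ) (k + 1)).indicator (fun _ => g k) y := by
  funext y
  rw [stepFun]
  split_ifs with hy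
  · rw [Finset.sum_eq_single ⌊y⌋₊]
    · rw [Set.indicator_of_mem]
      exact ⟨Nat.floor_le hy, Nat.lt_floor_add_one y⟩
    · intro k _ hk
      rw [Set.indicator_of_notMem]
      intro h
      exact hk ((Nat.floor_eq_iff hy).2 h).symm
    · intro h
      rw [hg _ (by simpa using h)]
      simp
  · refine (Finset.sum_eq_zero fun k _ => ?_).symm
    rw [Set.indicator_of_notMem]
    intro h
    have : (0 : ℝ) ≤ k := by positivity
    exact hy (this.trans h.1)

lemma measurable_stepFun (g : ℕ → ℝ) : Measurable (stepFun g) :=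
  Measurable.ite measurableSet_Ici ((measurable_from_nat (f := g)).comp Nat.measurable_floor)
    measurable_const

lemma integral_stepFun {g : ℕ → ℝ} {N : ℕ} (hg : ∀ k, N ≤ k → g k = 0) :
    ∫ y, stepFun g y = ∑ k ∈ Finset.range N, g k := by
  rw [stepFun_eq_sum hg, MeasureTheory.integral_finsetSum]
  · refine Finset.sum_congr rfl fun k _ => ?_
    rw [MeasureTheory.integral_indicator_const _ measurableSet_Ico]
    simp [MeasureTheory.measureReal_def]
  · intro k _
    rw [MeasureTheory.integrable_indicator_iff measurableSet_Ico]
    exact MeasureTheory.integrableOn_const (by simp)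

lemma integral_stepFun_comp {g : ℕ → ℝ} {N : ℕ} (hg : ∀ k, N ≤ k → g k = 0) (c : ℝ) {r : ℝ}
    (hr : 0 < r) : ∫ t, stepFun g (c + r * t) = (∑ k ∈ Finset.range N, g k) / r := by
  rw [MeasureTheory.Measure.integral_comp_mul_left (fun y => stepFun g (c + y)) r,
    MeasureTheory.integral_add_left_eq_self (stepFun g) c, integral_stepFun hg,
    abs_of_pos (inv_pos.2 hr), smul_eq_mul]
  field_simp

/-- The index nearest below the peak `n/√2` displaced by `t√n`. -/
noncomputable def peakIndex (t : ℝ) (n : ℕ) : ℕ := ⌊(n : ℝ) * (1 / √2) + √n * t⌋₊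

lemma abs_peakIndex_sub_le {t : ℝ} {n : ℕ} (hn : 0 < n)
    (h : 0 ≤ (n : ℝ) * (1 / √2) + √n * t) :
    |√n * ((peakIndex t n : ℝ) / n - 1 / √2) - t| ≤ 1 / √n := by
  have hn' : (0 : ℝ) < n := by exact_mod_cast hn
  have hr : 0 < √(n : ℝ) := Real.sqrt_pos.2 hn'
  have hr2 : √(n : ℝ) * √n = n := Real.mul_self_sqrt hn'.le
  have h1 : (peakIndex t n : ℝ) ≤ _ := Nat.floor_le h
  have h2 := Nat.lt_floor_add_one ((n : ℝ) * (1 / √2) + √n * t)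
  change _ < (peakIndex t n : ℝ) + 1 at h2
  have e : √n * ((peakIndex t n : ℝ) / n - 1 / √2) - t =
      (peakIndex t n - (n * (1 / √2) + √n * t)) / √n := by
    rw [eq_div_iff hr.ne']
    have : (peakIndex t n : ℝ) / n * n = peakIndex t n := by field_simp
    linear_combination ((peakIndex t n : ℝ) / n - 1 / √2) * hr2 + this
  rw [e, abs_div, abs_of_pos hr]
  gcongr
  rw [abs_le]
  constructor <;> linarith

lemma eventually_peak_nonneg (t : ℝ) :
    ∀ᶠ n : ℕ in atTop, 0 ≤ (n : ℝ) * (1 / √2) + √n * t := by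
  have h : Tendsto (fun n : ℕ => √(n : ℝ)) atTop atTop :=
    tendsto_sqrt_atTop.comp tendsto_natCast_atTop_atTop
  filter_upwards [h.eventually_ge_atTop (|t| * √2)] with n hn
  have hr2 : √(n : ℝ) * √n = n := Real.mul_self_sqrt (Nat.cast_nonneg n)
  have : |t| ≤ √n * (1 / √2) := by
    rw [mul_one_div, le_div_iff₀ (by positivity)]
    exact hn
  have h3 := neg_abs_le t
  rw [show (n : ℝ) * (1 / √2) + √n * t = √n * (√n * (1 / √2) + t) by
    linear_combination (-(1 / √2)) * hr2]
  exact mul_nonneg (Real.sqrt_nonneg _) (by linarith)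

lemma tendsto_one_div_sqrt_nat : Tendsto (fun n : ℕ => 1 / √(n : ℝ)) atTop (nhds 0) :=
  tendsto_const_nhds.div_atTop (tendsto_sqrt_atTop.comp tendsto_natCast_atTop_atTop)

lemma tendsto_sqrt_mul_peakIndex (t : ℝ) :
    Tendsto (fun n : ℕ => √n * ((peakIndex t n : ℝ) / n - 1 / √2)) atTop (nhds t) := by
  rw [tendsto_iff_norm_sub_tendsto_zero]
  refine squeeze_zero' (Eventually.of_forall fun _ => norm_nonneg _) ?_ tendsto_one_div_sqrt_nat
  filter_upwards [eventually_peak_nonneg t, eventually_gt_atTop 0] with n h hn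
  exact abs_peakIndex_sub_le hn h

lemma tendsto_peakIndex_div (t : ℝ) :
    Tendsto (fun n : ℕ => (peakIndex t n : ℝ) / n) atTop (nhds (1 / √2)) := by
  have h := ((tendsto_sqrt_mul_peakIndex t).mul tendsto_one_div_sqrt_nat).add_const (1 / √2)
  rw [mul_zero, zero_add] at h
  refine h.congr' ?_
  filter_upwards [eventually_gt_atTop 0] with n hn
  have hr : 0 < √(n : ℝ) := Real.sqrt_pos.2 (by exact_mod_cast hn)
  field_simp
  ring

lemma tendsto_aperyWeight_peakIndex (t : ℝ) :
    Tendsto (fun n => aperyWeight n (peakIndex t n)) atTop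
      (nhds ((1 + √2) ^ 2 / (2 * π ^ 2) * exp (-(4 * √2) * t ^ 2))) := by
  obtain ⟨ha, hb⟩ := inv_sqrt_two_mem
  have hx := tendsto_peakIndex_div t
  have hmem : ∀ᶠ n : ℕ in atTop, 0 < n ∧ (n : ℝ) / 2 ≤ peakIndex t n ∧
      (peakIndex t n : ℝ) ≤ 9 / 10 * n := by
    filter_upwards [hx.eventually (Ioo_mem_nhds (show (1 / 2 : ℝ) < 1 / √2 by linarith)
      (show 1 / √2 < (9 / 10 : ℝ) by linarith)), eventually_gt_atTop 0] with n h hn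
    have hn' : (0 : ℝ) < n := by exact_mod_cast hn
    have h1 := (lt_div_iff₀ hn').1 h.1
    have h2 := (div_lt_iff₀ hn').1 h.2
    exact ⟨hn, by linarith, by linarith⟩
  have hk : Tendsto (peakIndex t) atTop atTop := by
    rw [← tendsto_natCast_atTop_iff (R := ℝ)]
    refine tendsto_atTop_mono' _ (hmem.mono fun n h => h.2.1) ?_
    exact tendsto_natCast_atTop_atTop.atTop_div_const (by norm_num)
  have hnk : Tendsto (fun n => n - peakIndex t n) atTop atTop := by
    rw [← tendsto_natCast_atTop_iff (R := ℝ)]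
    refine tendsto_atTop_mono' _ (f₁ := fun n : ℕ => (n : ℝ) / 10) (hmem.mono fun n h => ?_)
      (tendsto_natCast_atTop_atTop.atTop_div_const (by norm_num))
    have : peakIndex t n ≤ n := by
      have : (peakIndex t n : ℝ) ≤ n := by linarith [h.2.2, (Nat.cast_nonneg n : (0 : ℝ) ≤ n)]
      exact_mod_cast this
    simp only [Nat.cast_sub this]
    linarith [h.2.2]
  have hnk' : Tendsto (fun n => n + peakIndex t n) atTop atTop :=
    tendsto_atTop_mono (fun n => Nat.le_add_right n _) tendsto_id
  have hS := Stirling.tendsto_stirlingSeq_sqrt_pi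
  have hπ : 0 < √π := Real.sqrt_pos.2 Real.pi_pos
  have hπ2 : √π ^ 2 = π := Real.sq_sqrt Real.pi_pos.le
  have L1 := (hS.comp hnk').div (((hS.comp hk).pow 2).mul (hS.comp hnk)) (by positivity)
  have L2 := ((((hx.const_add 1).div (hx.const_sub 1) (by linarith)).sqrt).div
    (hx.const_mul 2) (by positivity))
  have L3 := (tendsto_mul_aperyRate_sub hx (w := fun n : ℕ => (n : ℝ)) (T := t ^ 2) (by
    refine ((tendsto_sqrt_mul_peakIndex t).pow 2).congr fun n => ?_
    rw [mul_pow, Real.sq_sqrt (Nat.cast_nonneg n)])).rexp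
  have L := ((L1.mul L2).mul L3).pow 2
  have hval : (√π / (√π ^ 2 * √π) * (√((1 + 1 / √2) / (1 - 1 / √2)) / (2 * (1 / √2))) *
      exp (-(2 * √2) * t ^ 2)) ^ 2 =
      (1 + √2) ^ 2 / (2 * π ^ 2) * exp (-(4 * √2) * t ^ 2) := by
    have h0 : 0 < 1 - 1 / √2 := by linarith
    rw [mul_pow, ← exp_nat_mul, hπ2, mul_pow, div_pow, div_pow, Real.sq_sqrt (by positivity),
      mul_pow, mul_pow, hπ2, inv_sqrt_two_sq]
    have h2 := Real.sq_sqrt (show (0 : ℝ) ≤ 2 by norm_num)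
    have h1 : (1 + 1 / √2) / (1 - 1 / √2) = (1 + √2) ^ 2 := by
      rw [div_eq_iff h0.ne']
      field_simp
      nlinarith
    rw [h1, show ((2 : ℕ) : ℝ) * (-(2 * √2) * t ^ 2) = -(4 * √2) * t ^ 2 by push_cast; ring]
    have := Real.pi_pos
    field_simp
    exact Real.sq_sqrt (by positivity)
  rw [hval] at L
  refine L.congr' ?_
  filter_upwards [hmem] with n ⟨hn, hlo, hhi⟩
  have hn' : (0 : ℝ) < n := by exact_mod_cast hn
  have hk0 : 0 < peakIndex t n := by
    have : (0 : ℝ) < peakIndex t n := by linarith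
    exact_mod_cast this
  have hkn : peakIndex t n < n := by
    have : (peakIndex t n : ℝ) < n := by linarith
    exact_mod_cast this
  rw [aperyWeight, aperyTerm_eq_stirling hk0 hkn, mul_assoc _ (exp _) (exp _), ← exp_add,
    show (n : ℝ) * aperyRate (peakIndex t n / n) + -(n * aperyRate (1 / √2)) =
      n * (aperyRate (peakIndex t n / n) - aperyRate (1 / √2)) by ring]
  rfl

lemma tendsto_sum_aperyWeight :
    Tendsto (fun n : ℕ => (∑ k ∈ Finset.range (n + 1), aperyWeight n k) / √n) atTop
      (nhds ((1 + √2) ^ 2 / (2 * π ^ 2) * √(π / (4 * √2)))) := by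
  have hdom := MeasureTheory.tendsto_integral_filter_of_dominated_convergence
    (μ := MeasureTheory.volume) (l := atTop)
    (F := fun (n : ℕ) (t : ℝ) => stepFun (aperyWeight n) ((n : ℝ) * (1 / √2) + √n * t))
    (f := fun t => (1 + √2) ^ 2 / (2 * π ^ 2) * exp (-(4 * √2) * t ^ 2))
    (fun t => 160000 * exp (1 / 2) * exp (-(1 / 4) * t ^ 2)) ?_ ?_ ?_ ?_
  · rw [MeasureTheory.integral_const_mul, integral_gaussian] at hdom
    refine hdom.congr' ?_
    filter_upwards [eventually_gt_atTop 0] with n hn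
    refine integral_stepFun_comp (fun k hk => ?_) _ (Real.sqrt_pos.2 (by exact_mod_cast hn))
    rw [aperyWeight, aperyTerm_eq_zero (by omega)]
    simp
  · refine Eventually.of_forall fun n => Measurable.aestronglyMeasurable ?_
    exact (measurable_stepFun _).comp (by fun_prop)
  · filter_upwards [eventually_gt_atTop 0] with n hn
    refine Eventually.of_forall fun t => ?_
    rw [stepFun]
    split_ifs with h
    · have hw := aperyWeight_le hn (k := peakIndex t n)
      have hw0 : 0 ≤ aperyWeight n (peakIndex t n) := sq_nonneg _
      have hu := abs_peakIndex_sub_le hn h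
      have hn' : (1 : ℝ) ≤ n := by exact_mod_cast hn
      have h1 : 1 / √(n : ℝ) ≤ 1 := by
        rw [div_le_one (by positivity)]; exact Real.one_le_sqrt.2 hn'
      obtain ⟨h2, h3⟩ := abs_le.1 (hu.trans h1)
      change ‖aperyWeight n (peakIndex t n)‖ ≤ _
      rw [Real.norm_eq_abs, abs_of_nonneg hw0]
      refine hw.trans ?_
      rw [mul_assoc, ← exp_add]
      gcongr
      have e : (n : ℝ) * ((peakIndex t n : ℝ) / n - 1 / √2) ^ 2 =
          (√n * ((peakIndex t n : ℝ) / n - 1 / √2)) ^ 2 := by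
        rw [mul_pow, Real.sq_sqrt (Nat.cast_nonneg n)]
      rw [e]
      generalize √n * ((peakIndex t n : ℝ) / n - 1 / √2) = u at *
      nlinarith [sq_nonneg (2 * u - t)]
    · rw [norm_zero]; positivity
  · exact (integrable_exp_neg_mul_sq (by norm_num)).const_mul _
  · refine Eventually.of_forall fun t => ?_
    refine (tendsto_aperyWeight_peakIndex t).congr' ?_
    filter_upwards [eventually_peak_nonneg t] with n h
    rw [stepFun, if_pos h, peakIndex]

lemma exp_mul_aperyRate_inv_sqrt_two (n : ℕ) :
    exp (n * aperyRate (1 / √2)) = (1 + √2) ^ (2 * n) := by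
  rw [aperyRate_inv_sqrt_two, show (n : ℝ) * (2 * log (1 + √2)) = ((2 * n : ℕ) : ℝ) * log (1 + √2) by
    push_cast; ring, exp_nat_mul, exp_log (by positivity)]

lemma sum_aperyWeight (n : ℕ) :
    ∑ k ∈ Finset.range (n + 1), aperyWeight n k = n ^ 2 * aperyA n / (1 + √2) ^ (4 * n) := by
  rw [aperyA, Finset.mul_sum, Finset.sum_div]
  refine Finset.sum_congr rfl fun k _ => ?_
  rw [aperyWeight, exp_neg, exp_mul_aperyRate_inv_sqrt_two, mul_pow, mul_pow, inv_pow, ← pow_mul,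
    show 2 * n * 2 = 4 * n by ring, div_eq_mul_inv]

/-- The squared form of `Aₙ ∼ (1+√2)²/(2π√2)^(3/2) · (1+√2)^(4n) n^(-3/2)`. -/
lemma tendsto_aperyA_normalized :
    Tendsto (fun n : ℕ => (n : ℝ) * √n * aperyA n / (1 + √2) ^ (4 * n)) atTop
      (nhds ((1 + √2) ^ 2 / (2 * π ^ 2) * √(π / (4 * √2)))) := by
  refine tendsto_sum_aperyWeight.congr' ?_
  filter_upwards [eventually_gt_atTop 0] with n hn
  have hn' : (0 : ℝ) < n := by exact_mod_cast hn
  have hr : 0 < √(n : ℝ) := Real.sqrt_pos.2 hn'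
  rw [sum_aperyWeight]
  have := Real.sq_sqrt hn'.le
  have hne : (1 + √2 : ℝ) ≠ 0 := by positivity
  rw [div_div, div_eq_div_iff (by positivity) (by positivity)]
  linear_combination (-(n * aperyA n * (1 + √2) ^ (4 * n)) : ℝ) * this

lemma tendsto_div_succ_nat : Tendsto (fun n : ℕ => (n : ℝ) / (n + 1)) atTop (nhds 1) :=
  tendsto_natCast_div_add_atTop 1

lemma aperyB_div_aperyA_succ_sub (n : ℕ) :
    aperyB (n + 1) / aperyA (n + 1) - aperyB n / aperyA n =
      6 / (((n : ℝ) + 1) ^ 3 * aperyA n * aperyA (n + 1)) := by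
  have h := apery_casoratian n
  have h0 := (aperyA_pos n).ne'
  have h1 := (aperyA_pos (n + 1)).ne'
  have h2 : (n : ℝ) + 1 ≠ 0 := by positivity
  rw [div_sub_div _ _ h1 h0, div_eq_div_iff (by positivity) (by positivity)]
  linear_combination aperyA (n + 1) * aperyA n * h

/-- The squared leading constant in the asymptotics of the Apéry numbers. -/
lemma aperyConst_sq :
    ((1 + √2) ^ 2 / (2 * π ^ 2) * √(π / (4 * √2))) ^ 2 =
      (1 + √2) ^ 4 / (16 * √2 * π ^ 3) := by
  have := Real.pi_pos
  rw [mul_pow, Real.sq_sqrt (by positivity)]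
  field_simp
  norm_num

lemma tendsto_aperyB_div_aperyA_sub :
    Tendsto (fun n : ℕ => (aperyB (n + 1) / aperyA (n + 1) - aperyB n / aperyA n) /
      (1 / (1 + √2) ^ 8) ^ n) atTop (nhds (96 * √2 * π ^ 3 / (1 + √2) ^ 8)) := by
  have hπ := Real.pi_pos
  have hL := tendsto_aperyA_normalized
  have hC : (0 : ℝ) < (1 + √2) ^ 2 / (2 * π ^ 2) * √(π / (4 * √2)) := by positivity
  have hCsq := aperyConst_sq
  set C := (1 + √2) ^ 2 / (2 * π ^ 2) * √(π / (4 * √2))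
  have hLs := (tendsto_add_atTop_iff_nat 1).2 hL
  have hr := tendsto_div_succ_nat
  have hrs := hr.sqrt
  have H := (((hr.mul hrs).const_mul 6).div (hL.mul hLs) (by positivity)).div_const ((1 + √2) ^ 4)
  have hval : 6 * (1 * √1) / (C * C) / (1 + √2) ^ 4 = 96 * √2 * π ^ 3 / (1 + √2) ^ 8 := by
    rw [← sq C, hCsq, Real.sqrt_one]
    field_simp
    norm_num
  rw [hval] at H
  refine H.congr' ?_
  filter_upwards [eventually_gt_atTop 0] with n hn
  have hn' : (0 : ℝ) < n := by exact_mod_cast hn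
  have hA := aperyA_pos n
  have hA1 := aperyA_pos (n + 1)
  have hs : 0 < √(n : ℝ) := Real.sqrt_pos.2 hn'
  have hs1 : 0 < √((n : ℝ) + 1) := Real.sqrt_pos.2 (by positivity)
  have hsq1 : √((n : ℝ) + 1) ^ 2 = n + 1 := Real.sq_sqrt (by positivity)
  rw [aperyB_div_aperyA_succ_sub]
  simp only [Pi.div_apply]
  rw [Real.sqrt_div hn'.le]
  push_cast
  generalize aperyA n = x at *
  generalize aperyA (n + 1) = y at *
  have hb : (0 : ℝ) < 1 + √2 := by positivity
  rw [← hsq1]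
  generalize √((n : ℝ) + 1) = w at *
  generalize √(n : ℝ) = v at *
  generalize 1 + √2 = b at *
  have e : b ^ (4 * (n + 1)) = b ^ (4 * n) * b ^ 4 := by rw [← pow_add]; ring_nf
  have e8 : (b ^ 8) ^ n = b ^ (4 * n) * b ^ (4 * n) := by rw [← pow_mul, ← pow_add]; ring_nf
  rw [one_div, inv_pow, e8, e]
  field_simp
  rw [Real.sqrt_sq hs1.le]

lemma tendsto_zeta_three_sub_div_pow :
    Tendsto (fun n : ℕ => ((∑' k : ℕ, 1 / ((k : ℝ) + 1) ^ 3) - aperyB n / aperyA n) /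
      (1 / (1 + √2) ^ 8) ^ n) atTop (nhds (4 * π ^ 3 / (1 + √2) ^ 4)) := by
  have hs := Real.sq_sqrt (show (0 : ℝ) ≤ 2 by norm_num)
  have hs0 : 0 < √2 := by positivity
  have hb8 : (1 : ℝ) < (1 + √2) ^ 8 := one_lt_pow₀ (by linarith) (by norm_num)
  have hlim := tendsto_aperyB_div_aperyA.const_sub (∑' k : ℕ, 1 / ((k : ℝ) + 1) ^ 3)
  rw [sub_self] at hlim
  have h := tendsto_div_pow_of_tendsto_sub_div_pow (β := 1 / (1 + √2) ^ 8)
    (e := fun n => (∑' k : ℕ, 1 / ((k : ℝ) + 1) ^ 3) - aperyB n / aperyA n)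
    (D := 96 * √2 * π ^ 3 / (1 + √2) ^ 8) (by positivity)
    (by rw [div_lt_one (by positivity)]; exact hb8)
    hlim
    (by simpa only [sub_sub_sub_cancel_left] using tendsto_aperyB_div_aperyA_sub)
  convert h using 2
  have hb4 : (1 + √2) ^ 4 = 17 + 12 * √2 := by
    linear_combination (√2 ^ 2 + 4 * √2 + 8) * hs
  have hb8' : (1 + √2) ^ 8 = 24 * √2 * (1 + √2) ^ 4 + 1 := by
    have : (1 + √2) ^ 8 = ((1 + √2) ^ 4) ^ 2 := by ring
    rw [this, hb4]
    linear_combination (-144) * hs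
  have hden : (0 : ℝ) < (1 + √2) ^ 8 - 1 := by linarith
  have h1 : 1 - 1 / (1 + √2) ^ 8 = ((1 + √2) ^ 8 - 1) / (1 + √2) ^ 8 := by field_simp
  rw [h1, div_div_div_cancel_right₀ (by positivity), hb8', add_sub_cancel_right]
  field_simp
  norm_num

/-- Big Apéry: the continued fraction `[[0,(2n-1)(17n²-17n+5)],[6,-n⁶]]` converges to
`ζ(3)`, with speed `4π³/(1+√2)^(8n+4)`. -/
theorem big_apery (p q : ℕ → ℝ)
    (hp : ∀ n : ℕ, 2 ≤ n →
      p n = (2 * (n : ℝ) - 1) * (17 * (n : ℝ) ^ 2 - 17 * (n : ℝ) + 5) * p (n - 1)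
              - ((n : ℝ) - 1) ^ 6 * p (n - 2))
    (hq : ∀ n : ℕ, 2 ≤ n →
      q n = (2 * (n : ℝ) - 1) * (17 * (n : ℝ) ^ 2 - 17 * (n : ℝ) + 5) * q (n - 1)
              - ((n : ℝ) - 1) ^ 6 * q (n - 2))
    (hp0 : p 0 = 0) (hp1 : p 1 = 6) (hq0 : q 0 = 1) (hq1 : q 1 = 5) :
    (∀ n, q n ≠ 0) ∧
    Tendsto (fun n => p n / q n) atTop (nhds (∑' k : ℕ, 1 / ((k : ℝ) + 1) ^ 3)) ∧
    (fun n : ℕ => (∑' k : ℕ, 1 / ((k : ℝ) + 1) ^ 3) - p n / q n) ~[atTop]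
      (fun n : ℕ => 4 * π ^ 3 / (1 + Real.sqrt 2) ^ (8 * n + 4)) := by
  have hpB : ∀ n, p n = (n.factorial : ℝ) ^ 3 * aperyB n :=
    eq_factorial_cube_mul hp aperyB_recurrence (by rw [hp0, aperyB_zero]) (by rw [hp1, aperyB_one])
  have hqA : ∀ n, q n = (n.factorial : ℝ) ^ 3 * aperyA n :=
    eq_factorial_cube_mul hq aperyA_recurrence (by rw [hq0, aperyA_zero]) (by rw [hq1, aperyA_one])
  have hpq : ∀ n, p n / q n = aperyB n / aperyA n := fun n => by
    rw [hpB, hqA, mul_div_mul_left _ _ (by positivity)]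
  simp only [hpq]
  refine ⟨fun n => ?_, tendsto_aperyB_div_aperyA, ?_⟩
  · rw [hqA]
    exact mul_ne_zero (by positivity) (aperyA_pos n).ne'
  · have hπ := Real.pi_pos
    refine isEquivalent_of_tendsto_one ?_
    have h := tendsto_zeta_three_sub_div_pow.div_const (4 * π ^ 3 / (1 + √2) ^ 4)
    rw [div_self (by positivity)] at h
    refine h.congr fun n => ?_
    rw [Pi.div_apply, div_div]
    congr 1
    rw [one_div, inv_pow, ← pow_mul, pow_add]
    field_simp
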